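/- arXiv:1110.5625 — 9 statements merged into one kernel-verified Lean document; each statement's English description precedes it below -/
import Mathlib

section
/- Let α₁ : X₁ → Y and α₂ : X₂ → Y be morphisms in an additive category that are both right minimal and both right determined by an object C. Then α₁ and α₂ are isomorphic (i.e., there exists an isomorphism φ : X₁ → X₂ with α₁ = α₂ ∘ φ) if and only if Im Hom(C, α₁) = Im Hom(C, α₂) as subgroups of Hom(C, Y). -/
open CategoryTheory CategoryTheory.Limits Opposite

universe v u

/-- `α'` factors through `α` (both morphisms ending at the same object). -/
def FactorsThru {C : Type*} [Category C] {X' X Y : C} (α' : X' ⟶ Y) (α : X ⟶ Y) : Prop :=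
  ∃ φ : X' ⟶ X, φ ≫ α = α'

/-- A morphism `α : X ⟶ Y` is right determined by an object `c` if for every morphism
`α' : X' ⟶ Y`, `α'` factors through `α` iff for every `φ : c ⟶ X'` the composite
`φ ≫ α'` factors through `α`. -/
def RightDetermined {C : Type*} [Category C] {X Y : C} (α : X ⟶ Y) (c : C) : Prop :=
  ∀ ⦃X' : C⦄ (α' : X' ⟶ Y),
    FactorsThru α' α ↔ ∀ φ : c ⟶ X', FactorsThru (φ ≫ α') α

/-- A morphism is left determined by `c` if it is right determined by `c` as a morphism
of the opposite category. -/
def LeftDetermined {C : Type*} [Category C] {X Y : C} (α : X ⟶ Y) (c : C) : Prop :=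
  RightDetermined α.op (op c)

/-- `α : X ⟶ Y` is right minimal if every `φ : X ⟶ X` with `φ ≫ α = α` is an isomorphism. -/
def RightMinimal {C : Type*} [Category C] {X Y : C} (α : X ⟶ Y) : Prop :=
  ∀ φ : X ⟶ X, φ ≫ α = α → IsIso φ

/-- The image of the induced map `Hom(c, X) → Hom(c, Y)`, as a subset of `Hom(c, Y)`. -/
def ImHom {C : Type*} [Category C] (c : C) {X Y : C} (α : X ⟶ Y) : Set (c ⟶ Y) :=
  {g : c ⟶ Y | ∃ f : c ⟶ X, f ≫ α = g}
/-- Lemma `le:uni`. Let `α₁ : X₁ ⟶ Y` and `α₂ : X₂ ⟶ Y` be morphisms in an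
additive category that are right minimal and right determined by an object `c`.  Then `α₁` and
`α₂` are isomorphic iff `Im Hom(c, α₁) = Im Hom(c, α₂)`. -/
theorem stmt_0 {C : Type u} [Category.{v} C] [Preadditive C] [HasFiniteBiproducts C]
    {X₁ X₂ Y c : C} (α₁ : X₁ ⟶ Y) (α₂ : X₂ ⟶ Y)
    (h₁min : RightMinimal α₁) (h₂min : RightMinimal α₂)
    (h₁det : RightDetermined α₁ c) (h₂det : RightDetermined α₂ c) :
    (∃ φ : X₁ ≅ X₂, φ.hom ≫ α₂ = α₁) ↔ ImHom c α₁ = ImHom c α₂ := by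
  constructor
  · rintro ⟨φ, rfl⟩
    ext g
    constructor
    · rintro ⟨f, rfl⟩
      exact ⟨f ≫ φ.hom, by simp⟩
    · rintro ⟨f, rfl⟩
      exact ⟨f ≫ φ.inv, by simp⟩
  · intro h
    obtain ⟨f, hf⟩ : FactorsThru α₁ α₂ := (h₂det α₁).2 fun φ => by
      have hm : φ ≫ α₁ ∈ ImHom c α₁ := ⟨φ, rfl⟩
      rw [h] at hm
      exact hm
    obtain ⟨g, hg⟩ : FactorsThru α₂ α₁ := (h₁det α₂).2 fun φ => by
      have hm : φ ≫ α₂ ∈ ImHom c α₂ := ⟨φ, rfl⟩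
      rw [← h] at hm
      exact hm
    have i₁ : IsIso (f ≫ g) := h₁min _ (by rw [Category.assoc, hg, hf])
    have i₂ : IsIso (g ≫ f) := h₂min _ (by rw [Category.assoc, hf, hg])
    have e₁ : f ≫ (g ≫ inv (f ≫ g)) = 𝟙 _ := by
      rw [← Category.assoc, IsIso.hom_inv_id]
    have e₂ : (inv (g ≫ f) ≫ g) ≫ f = 𝟙 _ := by
      rw [Category.assoc, IsIso.inv_hom_id]
    have e₃ : inv (g ≫ f) ≫ g = g ≫ inv (f ≫ g) := by
      calc inv (g ≫ f) ≫ g = (inv (g ≫ f) ≫ g) ≫ (f ≫ (g ≫ inv (f ≫ g))) := by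
            rw [e₁, Category.comp_id]
        _ = ((inv (g ≫ f) ≫ g) ≫ f) ≫ (g ≫ inv (f ≫ g)) := by
            rw [Category.assoc (inv (g ≫ f) ≫ g) f]
        _ = g ≫ inv (f ≫ g) := by rw [e₂, Category.id_comp]
    exact ⟨⟨f, g ≫ inv (f ≫ g), e₁, by rw [← e₃, e₂]⟩, hf⟩
end

section
/- A morphism α : X → Y in an additive category is right almost split if and only if the following three conditions hold: Γ = End(Y) is a local ring, α is right determined by Y, and Im Hom(Y, α) = rad Γ (the Jacobson radical of Γ, viewed inside Hom(Y, Y) = Γ). -/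
open CategoryTheory CategoryTheory.Limits Opposite

universe v u

/-- `α : X ⟶ Y` is right almost split: it is not a retraction, and every morphism `X' ⟶ Y`
that is not a retraction factors through `α`. -/
def RightAlmostSplit {C : Type*} [Category C] {X Y : C} (α : X ⟶ Y) : Prop :=
  (¬ ∃ s : Y ⟶ X, s ≫ α = 𝟙 Y) ∧
  ∀ ⦃X' : C⦄ (α' : X' ⟶ Y), (¬ ∃ s : Y ⟶ X', s ≫ α' = 𝟙 Y) → FactorsThru α' α

theorem aux_unit {R : Type*} [Ring R] [Nontrivial R]
    (H : ∀ a b : R, a + b = 1 → (∃ s, a * s = 1) ∨ (∃ s, b * s = 1))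
    {g s : R} (h : g * s = 1) : s * g = 1 := by
  rcases H (s * g) (1 - s * g) (by abel) with ⟨t, ht⟩ | ⟨t, ht⟩
  · have h1 : g = g * t := by
      calc g = g * (s * g * t) := by rw [ht, mul_one]
        _ = (g * s) * (g * t) := by simp only [mul_assoc]
        _ = g * t := by rw [h, one_mul]
    calc s * g = s * (g * t) := by rw [← h1]
      _ = 1 := by rw [← mul_assoc, ht]
  · have h1 : g = 0 := by
      calc g = g * ((1 - s * g) * t) := by rw [ht, mul_one]
        _ = (g - (g * s) * g) * t := by noncomm_ring
        _ = 0 := by rw [h]; simp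
    rw [h1, zero_mul] at h
    exact absurd h zero_ne_one

theorem aux_jac {R : Type*} [Ring R] [IsLocalRing R] (x : R) :
    x ∈ (⊥ : Ideal R).jacobson ↔ ¬ ∃ s, x * s = 1 := by
  have H : ∀ a b : R, a + b = 1 → (∃ s, a * s = 1) ∨ (∃ s, b * s = 1) := fun a b hab =>
    (IsLocalRing.isUnit_or_isUnit_of_add_one hab).imp
      (fun h => h.exists_right_inv) (fun h => h.exists_right_inv)
  rw [Ideal.mem_jacobson_iff]
  constructor
  · rintro h ⟨s, hs⟩
    obtain ⟨z, hz⟩ := h (-s)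
    rw [Ideal.mem_bot] at hz
    have hs' := aux_unit H hs
    have : z * -s * x + z - 1 = -1 := by
      rw [mul_assoc, neg_mul, hs']; simp
    rw [this] at hz
    exact one_ne_zero (neg_eq_zero.mp hz)
  · intro h y
    rcases H (-(y * x)) (1 + y * x) (by abel) with ⟨t, ht⟩ | ⟨t, ht⟩
    · exfalso
      apply h
      have h2 : y * (x * -t) = 1 := by rw [← ht]; noncomm_ring
      have h3 := aux_unit H h2
      exact ⟨-t * y, by rw [← h3, mul_assoc]⟩
    · refine ⟨t, ?_⟩
      have := aux_unit H ht
      rw [Ideal.mem_bot, ← this]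
      noncomm_ring

/-- Auslander; Example `ex:ass`.  A morphism `α : X ⟶ Y` in an additive
category is right almost split iff `End Y` is a local ring, `α` is right determined by `Y`,
and `Im Hom(Y, α)` equals the Jacobson radical of `End Y`. -/
theorem stmt_1 {C : Type u} [Category.{v} C] [Preadditive C] [HasFiniteBiproducts C]
    {X Y : C} (α : X ⟶ Y) :
    RightAlmostSplit α ↔
      (IsLocalRing (End Y) ∧ RightDetermined α Y ∧
        {g : End Y | ∃ f : Y ⟶ X, f ≫ α = g}
          = ((⊥ : Ideal (End Y)).jacobson : Set (End Y))) := by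
  constructor
  · rintro ⟨h1, h2⟩
    have key : ∀ g : End Y, (∃ f : Y ⟶ X, f ≫ α = g) ↔ ¬ ∃ s : End Y, g * s = 1 := by
      intro g
      constructor
      · rintro ⟨f, rfl⟩ ⟨s, hs⟩
        exact h1 ⟨(s : Y ⟶ Y) ≫ f, by rw [Category.assoc]; exact hs⟩
      · intro h
        exact h2 g h
    have H : ∀ a b : End Y, a + b = 1 → (∃ s, a * s = 1) ∨ (∃ s, b * s = 1) := by
      intro a b hab
      by_contra! hc
      obtain ⟨f, hf⟩ := (key a).2 (by simpa using hc.1)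
      obtain ⟨f', hf'⟩ := (key b).2 (by simpa using hc.2)
      exact h1 ⟨f + f', by rw [Preadditive.add_comp, hf, hf']; exact hab⟩
    have hn : Nontrivial (End Y) := by
      refine ⟨0, 1, fun h => h1 ⟨0, ?_⟩⟩
      rw [zero_comp]; exact h
    have hl : IsLocalRing (End Y) := by
      refine ⟨fun {a b} hab => ?_⟩
      exact (H a b hab).imp
        (fun ⟨s, hs⟩ => ⟨⟨a, s, hs, aux_unit H hs⟩, rfl⟩)
        (fun ⟨s, hs⟩ => ⟨⟨b, s, hs, aux_unit H hs⟩, rfl⟩)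
    refine ⟨hl, ?_, ?_⟩
    · intro X' α'
      constructor
      · rintro ⟨f, rfl⟩ φ
        exact ⟨φ ≫ f, by simp⟩
      · intro h
        apply h2
        rintro ⟨s, hs⟩
        obtain ⟨f, hf⟩ := h s
        exact h1 ⟨f, hf.trans hs⟩
    · ext g
      exact (key g).trans (aux_jac g).symm
  · rintro ⟨hl, hd, hi⟩
    have key : ∀ g : End Y, (∃ f : Y ⟶ X, f ≫ α = g) ↔ ¬ ∃ s : End Y, g * s = 1 := by
      intro g
      rw [← aux_jac g]
      exact Set.ext_iff.1 hi g
    refine ⟨fun h => (key 1).1 h ⟨1, mul_one 1⟩, ?_⟩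
    intro X' α' h
    refine (hd α').2 fun φ => (key (φ ≫ α')).2 ?_
    rintro ⟨s, hs⟩
    exact h ⟨(s : Y ⟶ Y) ≫ φ, by rw [Category.assoc]; exact hs⟩
end

section
/- Let Λ be a ring, let C and Y be Λ-modules with C finitely presented, and let H ⊆ Hom_Λ(C, Y) be an End_Λ(C)-submodule (where End_Λ(C) acts by precomposition). Then there exists, up to isomorphism, a unique right minimal morphism α : X → Y in the category of all Λ-modules which is right determined by C and satisfies Im Hom_Λ(C, α) = H. -/
open CategoryTheory CategoryTheory.Limits Opposite

universe v u

/-- The left action of `(End c)ᵐᵒᵖ` on `c ⟶ X` given by precomposition; this encodes the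
structure of `Hom(c, X)` as a module over `Γ = End c` acting by precomposition. -/
instance endOpModule {C : Type*} [Category C] [Preadditive C] (c X : C) :
    Module (End c)ᵐᵒᵖ (c ⟶ X) where
  smul γ f := γ.unop ≫ f
  one_smul f := Category.id_comp f
  mul_smul γ₁ γ₂ f := by
    show ((γ₁ * γ₂).unop) ≫ f = γ₁.unop ≫ (γ₂.unop ≫ f)
    rw [MulOpposite.unop_mul]
    show (γ₁.unop ≫ γ₂.unop) ≫ f = _
    simp
  smul_zero γ := Limits.comp_zero
  smul_add γ f g := Preadditive.comp_add _ _ _ _ _ _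
  add_smul γ₁ γ₂ f := Preadditive.add_comp _ _ _ _ _ _
  zero_smul f := Limits.zero_comp

theorem endOpModule_smul_def {C : Type*} [Category C] [Preadditive C] {c X : C}
    (γ : (End c)ᵐᵒᵖ) (f : c ⟶ X) : γ • f = γ.unop ≫ f := rfl

theorem aux_pres {Λ C : Type u} [Ring Λ] [AddCommGroup C] [Module Λ C]
    [Module.FinitePresentation Λ C] :
    ∃ (n m : ℕ) (t : Fin n → C) (a : Fin m → Fin n → Λ),
      ∀ (X : Type u) [AddCommGroup X] [Module Λ X],
        (∀ φ ψ : C →ₗ[Λ] X, (∀ i, φ (t i) = ψ (t i)) → φ = ψ) ∧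
        (∀ φ : C →ₗ[Λ] X, ∀ j, ∑ i, a j i • φ (t i) = 0) ∧
        (∀ x : Fin n → X, (∀ j, ∑ i, a j i • x i = 0) → ∃ φ : C →ₗ[Λ] X, ∀ i, φ (t i) = x i) := by
  obtain ⟨n, m, f, g, hf, hfg⟩ := Module.FinitePresentation.exists_fin' Λ C
  have key : ∀ v : Fin n → Λ, v = ∑ i, v i • (Pi.single i 1 : Fin n → Λ) := fun v => by
    ext k; simp [Finset.sum_apply, Pi.single_apply]
  refine ⟨n, m, fun i => f (Pi.single i 1), fun j => g (Pi.single j 1), fun X _ _ => ⟨?_, ?_, ?_⟩⟩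
  · intro φ ψ h
    ext y
    obtain ⟨v, rfl⟩ := hf y
    rw [key v]
    simp [map_sum, h]
  · intro φ j
    have h1 : f (g (Pi.single j 1)) = 0 := hfg.apply_apply_eq_zero _
    rw [key (g (Pi.single j 1))] at h1
    have := congrArg φ h1
    simpa [map_sum] using this
  · intro x hx
    let l : (Fin n → Λ) →ₗ[Λ] X := Fintype.linearCombination Λ x
    have hl : ∀ v, l v = ∑ i, v i • x i := fun v => by simp [l, Fintype.linearCombination_apply]
    have hle : LinearMap.ker f ≤ LinearMap.ker l := by
      intro v hv
      obtain ⟨w, rfl⟩ := (hfg v).1 hv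
      have key2 : w = ∑ j, w j • (Pi.single j 1 : Fin m → Λ) := by
        ext k; simp [Finset.sum_apply, Pi.single_apply]
      rw [LinearMap.mem_ker, key2, map_sum, map_sum]
      refine Finset.sum_eq_zero fun j _ => ?_
      rw [map_smul, map_smul, hl, hx, smul_zero]
    refine ⟨(LinearMap.ker f).liftQ l hle ∘ₗ (f.quotKerEquivOfSurjective hf).symm.toLinearMap,
      fun i => ?_⟩
    have : (f.quotKerEquivOfSurjective hf).symm (f (Pi.single i 1)) =
        (LinearMap.ker f).mkQ (Pi.single i 1) := by
      rw [LinearEquiv.symm_apply_eq]; rfl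
    simp [this, hl, Pi.single_apply]

theorem aux_ext {A B E : Type u} [AddCommGroup A] [AddCommGroup B] [AddCommGroup E]
    [DivisibleBy E ℤ] (f : A →+ B) (g : A →+ E) (h : ∀ x, f x = 0 → g x = 0) :
    ∃ k : B →+ E, ∀ x, k (f x) = g x := by
  let g' : (A ⧸ f.ker) →+ E := QuotientAddGroup.lift f.ker g (fun x hx => h x hx)
  obtain ⟨k, hk⟩ := (Module.Baer.of_divisible E).extension_property_addMonoidHom
    (QuotientAddGroup.kerLift f) (QuotientAddGroup.kerLift_injective f) g'
  refine ⟨k, fun x => ?_⟩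
  have := DFunLike.congr_fun hk (x : A ⧸ f.ker)
  exact this

/-- A compact Hausdorff divisible group receiving an injection. -/
theorem aux_emb (A : Type u) [AddCommGroup A] :
    ∃ (E : Type u) (_ : AddCommGroup E) (_ : DivisibleBy E ℤ) (_ : TopologicalSpace E)
      (_ : ContinuousAdd E) (_ : CompactSpace E) (_ : T2Space E) (χ : A →+ E),
      Function.Injective χ := by
  let p : AddCircle (1 : ℚ) →+ AddCircle (1 : ℝ) :=
    QuotientAddGroup.map _ _ (Rat.castHom ℝ).toAddMonoidHom (by
      intro x hx
      obtain ⟨n, rfl⟩ := AddSubgroup.mem_zmultiples_iff.1 hx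
      refine AddSubgroup.mem_zmultiples_iff.2 ⟨n, by simp⟩)
  have hp : ∀ x, p x = 0 → x = 0 := by
    intro x
    induction x using QuotientAddGroup.induction_on with
    | H z =>
      intro hz
      have hz' : ((z : ℝ) : AddCircle (1 : ℝ)) = 0 := hz
      rw [AddCircle.coe_eq_zero_iff] at hz'
      obtain ⟨n, hn⟩ := hz'
      refine (AddCircle.coe_eq_zero_iff (1 : ℚ)).2 ⟨n, ?_⟩
      simp only [zsmul_eq_mul, mul_one] at hn ⊢
      exact_mod_cast hn
  have : Fact ((0 : ℝ) < 1) := ⟨one_pos⟩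
  refine ⟨CharacterModule A → AddCircle (1 : ℝ), inferInstance, inferInstance, inferInstance,
    inferInstance, inferInstance, inferInstance,
    AddMonoidHom.mk' (fun a c => p (c a)) (fun a b => by ext c; simp), ?_⟩
  rw [injective_iff_map_eq_zero]
  intro a ha
  refine CharacterModule.eq_zero_of_character_apply fun c => hp _ (congrFun ha c)

theorem aux_semigroup {M : Type*} [Monoid M] [TopologicalSpace M] [CompactSpace M] [T2Space M]
    (hc : ∀ r : M, Continuous (· * r)) :
    ∃ e : M, e * e = e ∧ ∀ f : M, e * f = f → f * e = f →
      ∃ g : M, e * g = g ∧ g * e = g ∧ g * f = e ∧ f * g = e := by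
  let S : Set (Set M) := { N | IsClosed N ∧ N.Nonempty ∧ ∀ m, ∀ x ∈ N, m * x ∈ N }
  obtain ⟨N, hN⟩ : ∃ N', Minimal (· ∈ S) N' := by
    refine zorn_superset _ fun c hcs hc => ?_
    refine
      ⟨⋂₀ c, ⟨isClosed_sInter fun t ht => (hcs ht).1, ?_, fun m x hx => ?_⟩, fun s hs =>
        Set.sInter_subset_of_mem hs⟩
    · obtain rfl | hcnemp := c.eq_empty_or_nonempty
      · rw [Set.sInter_empty]
        apply Set.univ_nonempty
      convert!
        @IsCompact.nonempty_iInter_of_directed_nonempty_isCompact_isClosed _ _ _ hcnemp.coe_sort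
          ((↑) : c → Set M) ?_ ?_ ?_ ?_
      · exact Set.sInter_eq_iInter
      · refine DirectedOn.directed_val (IsChain.directedOn hc.symm)
      exacts [fun i => (hcs i.prop).2.1, fun i => (hcs i.prop).1.isCompact, fun i => (hcs i.prop).1]
    · rw [Set.mem_sInter]
      exact fun t ht => (hcs ht).2.2 m x (Set.mem_sInter.mp hx t ht)
  obtain ⟨Nc, Nne, Nmul⟩ := hN.prop
  obtain ⟨e, heN, hee⟩ := exists_idempotent_in_compact_subsemigroup hc N Nne Nc.isCompact
    (fun x _ y hy => Nmul x y hy)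
  have himg : ∀ f ∈ N, (· * f) '' N = N := by
    intro f hf
    apply hN.eq_of_subset
    · refine ⟨(hc f).isClosedMap _ Nc, Nne.image _, ?_⟩
      rintro m _ ⟨x, hx, rfl⟩
      exact ⟨m * x, Nmul _ _ hx, mul_assoc _ _ _⟩
    · rintro _ ⟨x, hx, rfl⟩
      exact Nmul _ _ hf
  have hleft : ∀ f : M, e * f = f → f * e = f → ∃ g : M, e * g = g ∧ g * e = g ∧ g * f = e := by
    intro f h1 h2
    have hf : f ∈ N := h2 ▸ Nmul f e heN
    have : e ∈ (· * f) '' N := by rw [himg f hf]; exact heN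
    obtain ⟨g, hg, hgf⟩ := this
    have hgf : g * f = e := hgf
    refine ⟨e * g * e, ?_, ?_, ?_⟩
    · simp only [← mul_assoc, hee]
    · simp only [mul_assoc, hee]
    · rw [mul_assoc, h1, mul_assoc, hgf, hee]
  refine ⟨e, hee, fun f h1 h2 => ?_⟩
  obtain ⟨g, g1, g2, g3⟩ := hleft f h1 h2
  obtain ⟨k, k1, k2, k3⟩ := hleft g g1 g2
  refine ⟨g, g1, g2, g3, ?_⟩
  have : k = f := by
    calc k = k * e := k2.symm
      _ = (k * g) * f := by rw [← g3, mul_assoc]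
      _ = f := by rw [k3, h1]
  rw [← this, k3]

/-- Additive maps from the ring, with the left module structure from right multiplication. -/
def Coind (Λ E : Type u) [Ring Λ] [AddCommGroup E] : Type u := Λ →+ E

namespace Coind
variable {Λ E : Type u} [Ring Λ] [AddCommGroup E]

instance : AddCommGroup (Coind Λ E) := inferInstanceAs (AddCommGroup (Λ →+ E))

instance : FunLike (Coind Λ E) Λ E := inferInstanceAs (FunLike (Λ →+ E) Λ E)

instance : AddMonoidHomClass (Coind Λ E) Λ E :=
  inferInstanceAs (AddMonoidHomClass (Λ →+ E) Λ E)

theorem add_apply (f g : Coind Λ E) (r : Λ) : (f + g) r = f r + g r := rfl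

theorem zero_apply (r : Λ) : (0 : Coind Λ E) r = 0 := rfl

instance : SMul Λ (Coind Λ E) := ⟨fun s f =>
  (AddMonoidHom.mk' (fun r => f (r * s)) (fun x y => by rw [add_mul, map_add]) : Λ →+ E)⟩

theorem smul_apply (s : Λ) (f : Coind Λ E) (r : Λ) : (s • f) r = f (r * s) := rfl

instance : Module Λ (Coind Λ E) where
  one_smul f := DFunLike.ext _ _ fun r => by rw [smul_apply, mul_one]
  mul_smul s t f := DFunLike.ext _ _ fun r => by simp only [smul_apply, mul_assoc]
  smul_zero s := DFunLike.ext _ _ fun r => by simp only [smul_apply, zero_apply]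
  smul_add s f g := DFunLike.ext _ _ fun r => by simp only [smul_apply, add_apply]
  add_smul s t f := DFunLike.ext _ _ fun r => by
    simp only [smul_apply, add_apply, mul_add, map_add]
  zero_smul f := DFunLike.ext _ _ fun r => by
    simp only [smul_apply, zero_apply, mul_zero, map_zero]

/-- Evaluation at a ring element. -/
def ev (r : Λ) : Coind Λ E →+ E := AddMonoidHom.mk' (fun f => f r) (fun _ _ => rfl)

theorem ev_apply (r : Λ) (f : Coind Λ E) : ev r f = f r := rfl

end Coind

/-- The pullback module. -/
def PB {Λ E Y : Type u} [Ring Λ] [AddCommGroup E] [AddCommGroup Y] [Module Λ Y] {n m : ℕ}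
    (a : Fin m → Fin n → Λ) (g : (Fin n → Y) →+ E) :
    Submodule Λ (Y × (Fin m → Coind Λ E)) where
  carrier := {p | ∀ i (r : Λ), g (Pi.single i (r • p.1)) = ∑ j, p.2 j (a j i * r)}
  zero_mem' := by
    intro i r
    simp [Coind.zero_apply]
  add_mem' := by
    intro p q hp hq i r
    simp only [Prod.fst_add, Prod.snd_add, Pi.add_apply, smul_add, Pi.single_add, map_add,
      Coind.add_apply, Finset.sum_add_distrib, hp i r, hq i r]
  smul_mem' := by
    intro s p hp i r
    simp only [Prod.smul_fst, Prod.smul_snd, Pi.smul_apply, Coind.smul_apply, smul_smul, mul_assoc]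
    exact hp i (r * s)

section
variable {Λ E Y : Type u} [Ring Λ] [AddCommGroup E] [AddCommGroup Y] [Module Λ Y] {n m : ℕ}
    (a : Fin m → Fin n → Λ) (g : (Fin n → Y) →+ E)

/-- Endomorphisms over the base. -/
def EndPB : Submonoid (Module.End Λ (PB a g)) where
  carrier := {φ | ∀ x, (φ x).1.1 = x.1.1}
  one_mem' := fun _ => rfl
  mul_mem' := by
    intro φ ψ hφ hψ x
    exact (hφ (ψ x)).trans (hψ x)

/-- Coordinates of an endomorphism. -/
def EndPB.coord (φ : EndPB a g) : PB a g → Fin m → Λ → E := fun x j r => (φ.1 x).1.2 j r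

theorem EndPB.coord_injective : Function.Injective (EndPB.coord a g) := by
  intro φ ψ h
  apply Subtype.ext
  refine LinearMap.ext fun x => ?_
  apply Subtype.ext
  apply Prod.ext
  · exact (φ.2 x).trans (ψ.2 x).symm
  · funext j
    exact DFunLike.ext _ _ fun r => congrFun (congrFun (congrFun h x) j) r

theorem EndPB.range_coord : Set.range (EndPB.coord a g) =
    {b | (∀ x j r s, b x j (r + s) = b x j r + b x j s) ∧
      (∀ x y j r, b (x + y) j r = b x j r + b y j r) ∧
      (∀ (s : Λ) x j r, b (s • x) j r = b x j (r * s)) ∧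
      (∀ (x : PB a g) i (r : Λ), g (Pi.single i (r • x.1.1)) = ∑ j, b x j (a j i * r))} := by
  ext b
  constructor
  · rintro ⟨φ, rfl⟩
    refine ⟨fun x j r s => map_add _ _ _, fun x y j r => ?_, fun s x j r => ?_, fun x i r => ?_⟩
    · simp only [coord, map_add]; rfl
    · simp only [coord, map_smul]; rfl
    · rw [← φ.2 x]
      exact (φ.1 x).2 i r
  · rintro ⟨h1, h2, h3, h4⟩
    let β : PB a g → Fin m → Coind Λ E := fun x j =>
      (AddMonoidHom.mk' (b x j) (h1 x j) : Λ →+ E)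
    let φ : Module.End Λ (PB a g) :=
      { toFun := fun x => ⟨(x.1.1, β x), h4 x⟩
        map_add' := fun x y => by
          apply Subtype.ext
          apply Prod.ext
          · rfl
          · funext j
            exact DFunLike.ext _ _ fun r => h2 x y j r
        map_smul' := fun s x => by
          apply Subtype.ext
          apply Prod.ext
          · rfl
          · funext j
            exact DFunLike.ext _ _ fun r => h3 s x j r }
    exact ⟨⟨φ, fun x => rfl⟩, rfl⟩

theorem EndPB.exists_min [TopologicalSpace E] [ContinuousAdd E] [CompactSpace E] [T2Space E] :
    ∃ e : EndPB a g, e * e = e ∧ ∀ f : EndPB a g, e * f = f → f * e = f →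
      ∃ k : EndPB a g, e * k = k ∧ k * e = k ∧ k * f = e ∧ f * k = e := by
  let : TopologicalSpace (EndPB a g) := TopologicalSpace.induced (EndPB.coord a g) inferInstance
  have hev : ∀ x j r, Continuous fun b : PB a g → Fin m → Λ → E => b x j r := fun x j r => by
    fun_prop
  have hemb : Topology.IsClosedEmbedding (EndPB.coord a g) := by
    refine ⟨⟨⟨rfl⟩, EndPB.coord_injective a g⟩, ?_⟩
    rw [EndPB.range_coord]
    simp only [Set.ofPred_and, Set.ofPred_forall]
    refine IsClosed.inter ?_ (IsClosed.inter ?_ (IsClosed.inter ?_ ?_))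
    · refine isClosed_iInter fun x => isClosed_iInter fun j => isClosed_iInter fun r =>
        isClosed_iInter fun s => isClosed_eq ?_ ?_ <;> fun_prop
    · refine isClosed_iInter fun x => isClosed_iInter fun j => isClosed_iInter fun r =>
        isClosed_iInter fun s => isClosed_eq ?_ ?_ <;> fun_prop
    · refine isClosed_iInter fun x => isClosed_iInter fun j => isClosed_iInter fun r =>
        isClosed_iInter fun s => isClosed_eq ?_ ?_ <;> fun_prop
    · refine isClosed_iInter fun x => isClosed_iInter fun j => isClosed_iInter fun r =>
        isClosed_eq ?_ ?_ <;> fun_prop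
  have : CompactSpace (EndPB a g) := hemb.compactSpace
  have : T2Space (EndPB a g) := hemb.isEmbedding.t2Space
  refine aux_semigroup fun ψ => ?_
  rw [continuous_induced_rng]
  refine continuous_pi fun x => continuous_pi fun j => continuous_pi fun r => ?_
  have hcd : Continuous (EndPB.coord a g) := continuous_induced_dom
  exact (hev (ψ.1 x) j r).comp hcd

end

theorem aux_main {Λ : Type u} [Ring Λ] (c Y : ModuleCat.{u} Λ)
    [Module.FinitePresentation Λ c]
    (H : Submodule (End c)ᵐᵒᵖ (c ⟶ Y)) :
    ∃ (X : ModuleCat.{u} Λ) (α : X ⟶ Y), RightMinimal α ∧ (∀ φ : c ⟶ X, φ ≫ α ∈ H) ∧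
      ∀ (X' : ModuleCat.{u} Λ) (α' : X' ⟶ Y), (∀ φ : c ⟶ X', φ ≫ α' ∈ H) → FactorsThru α' α := by
  obtain ⟨n, m, t, a, hpres⟩ := aux_pres (Λ := Λ) (C := c)
  obtain ⟨E, _, _, _, _, _, _, χ₀, hχ₀⟩ := aux_emb ((c ⟶ Y) ⧸ H)
  let χ : (c ⟶ Y) →+ E := χ₀.comp H.mkQ.toAddMonoidHom
  have hχ : ∀ h, χ h = 0 ↔ h ∈ H := fun h => by
    rw [← Submodule.Quotient.mk_eq_zero H, ← map_eq_zero_iff χ₀ hχ₀]; rfl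
  let ev : (c ⟶ Y) →+ (Fin n → Y) := AddMonoidHom.mk' (fun h i => h.hom (t i)) (fun _ _ => rfl)
  obtain ⟨g, hg⟩ := aux_ext ev χ (by
    intro h hh
    have : h = 0 := by
      apply ModuleCat.hom_ext
      exact (hpres Y).1 _ _ fun i => congrFun hh i
    rw [this, map_zero])
  have hsum : ∀ {Z : Type u} [AddCommGroup Z] {k : ℕ} (g : (Fin k → Z) →+ E) (y : Fin k → Z),
      g y = ∑ i, g (Pi.single i (y i)) := by
    intro Z _ k g y
    rw [← map_sum, Finset.univ_sum_single]
  -- maps into the pullback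
  have hPBH : ∀ φ : c →ₗ[Λ] PB a g,
      ModuleCat.ofHom (LinearMap.fst Λ Y (Fin m → Coind Λ E) ∘ₗ (PB a g).subtype ∘ₗ φ) ∈ H := by
    intro φ
    rw [← hχ, ← hg, hsum]
    have h1 : ∀ i, g (Pi.single i ((φ (t i)).1.1)) = ∑ j, (φ (t i)).1.2 j (a j i) := fun i => by
      have := (φ (t i)).2 i 1
      simpa using this
    refine (Finset.sum_congr rfl fun i _ => h1 i).trans ?_
    rw [Finset.sum_comm]
    refine Finset.sum_eq_zero fun j _ => ?_
    have h2 := (hpres (PB a g)).2.1 φ j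
    let L : PB a g →+ E := (Coind.ev 1).comp ((Pi.evalAddMonoidHom _ j).comp
      ((LinearMap.snd Λ Y (Fin m → Coind Λ E) ∘ₗ (PB a g).subtype).toAddMonoidHom))
    have h3 := congrArg L h2
    rw [map_sum, map_zero] at h3
    rw [← h3]
    refine Finset.sum_congr rfl fun i _ => ?_
    change _ = (φ (t i)).1.2 j (1 * a j i)
    rw [one_mul]
  have hPBF : ∀ (X' : ModuleCat.{u} Λ) (α' : X' ⟶ Y), (∀ φ : c ⟶ X', φ ≫ α' ∈ H) →
      ∃ ψ : X' →ₗ[Λ] PB a g, ∀ x, (ψ x).1.1 = α'.hom x := by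
    intro X' α' hα'
    let A : (Fin n → X') →+ (Fin m → X') :=
      AddMonoidHom.mk' (fun x j => ∑ i, a j i • x i) (fun x y => by
        funext j
        simp [smul_add, Finset.sum_add_distrib])
    let G : (Fin n → X') →+ E := g.comp
      (AddMonoidHom.mk' (fun x i => α'.hom (x i)) (fun x y => by funext j; simp))
    obtain ⟨b, hb⟩ := aux_ext A G (by
      intro x hx
      obtain ⟨φ, hφ⟩ := (hpres X').2.2 x fun j => congrFun hx j
      have h1 := (hχ _).2 (hα' (ModuleCat.ofHom φ))
      rw [← hg] at h1
      rw [← h1]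
      change g _ = g _
      congr 1
      funext i
      change _ = α'.hom (φ (t i))
      rw [hφ]
      rfl)
    let β : X' → Fin m → Coind Λ E := fun x j =>
      (AddMonoidHom.mk' (fun r : Λ => b (Pi.single j (r • x)))
        (fun r s => by rw [add_smul, Pi.single_add, map_add]) : Λ →+ E)
    have hβ : ∀ x j r, β x j r = b (Pi.single j (r • x)) := fun _ _ _ => rfl
    refine ⟨{ toFun := fun x => ⟨(α'.hom x, β x), ?_⟩, map_add' := ?_, map_smul' := ?_ },
      fun x => rfl⟩
    · intro i r
      simp only [hβ]
      have h1 := hb (Pi.single i (r • x))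
      rw [hsum b] at h1
      have h2 : G (Pi.single i (r • x)) = g (Pi.single i (r • α'.hom x)) := by
        change g _ = g _
        congr 1
        funext k
        by_cases hk : k = i
        · subst hk; simp
        · simp [hk]
      rw [← h2, ← h1]
      refine Finset.sum_congr rfl fun j _ => ?_
      congr 2
      change ∑ k, a j k • (Pi.single i (r • x) : Fin n → X') k = _
      rw [Finset.sum_eq_single i]
      · simp [smul_smul]
      · intro k _ hk; simp [hk]
      · simp
    · intro x y
      apply Subtype.ext
      apply Prod.ext
      · exact map_add _ _ _
      · funext j
        exact DFunLike.ext _ _ fun r => by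
          change b _ = b _ + b _
          rw [smul_add, Pi.single_add, map_add]
    · intro s x
      apply Subtype.ext
      apply Prod.ext
      · exact map_smul _ _ _
      · funext j
        exact DFunLike.ext _ _ fun r => by
          change b _ = b _
          rw [smul_smul]
          rfl
  obtain ⟨e, hee, hmin⟩ := EndPB.exists_min a g
  have hee' : ∀ x, e.1 (e.1 x) = e.1 x := fun x =>
    LinearMap.congr_fun (congrArg Subtype.val hee) x
  let R : Submodule Λ (PB a g) := LinearMap.range e.1
  have heR : ∀ x : R, e.1 x.1 = x.1 := by
    rintro ⟨_, x, rfl⟩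
    exact hee' x
  let π : R →ₗ[Λ] Y := LinearMap.fst Λ Y (Fin m → Coind Λ E) ∘ₗ (PB a g).subtype ∘ₗ R.subtype
  refine ⟨ModuleCat.of Λ R, ModuleCat.ofHom π, ?_, ?_, ?_⟩
  · intro φ hφ
    have hφ' : ∀ x : R, (φ.hom x).1.1.1 = x.1.1.1 := fun x =>
      LinearMap.congr_fun (congrArg ModuleCat.Hom.hom hφ) x
    let f : EndPB a g := ⟨R.subtype ∘ₗ φ.hom ∘ₗ e.1.rangeRestrict, fun x =>
      (hφ' _).trans (e.2 x)⟩
    have hf : ∀ x : R, f.1 x.1 = (φ.hom x).1 := fun x => by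
      change (φ.hom (e.1.rangeRestrict x.1)).1 = _
      congr 2
      exact Subtype.ext (heR x)
    obtain ⟨k, k1, k2, k3, k4⟩ := hmin f
      (Subtype.ext (LinearMap.ext fun x => heR (φ.hom (e.1.rangeRestrict x))))
      (Subtype.ext (LinearMap.ext fun x => by
        change (φ.hom (e.1.rangeRestrict (e.1 x))).1 = (φ.hom (e.1.rangeRestrict x)).1
        congr 2
        exact Subtype.ext (hee' x)))
    have k1' : ∀ x, e.1 (k.1 x) = k.1 x := fun x =>
      LinearMap.congr_fun (congrArg Subtype.val k1) x
    have k3' : ∀ x, k.1 (f.1 x) = e.1 x := fun x =>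
      LinearMap.congr_fun (congrArg Subtype.val k3) x
    have k4' : ∀ x, f.1 (k.1 x) = e.1 x := fun x =>
      LinearMap.congr_fun (congrArg Subtype.val k4) x
    let κ : R →ₗ[Λ] R := e.1.rangeRestrict ∘ₗ k.1 ∘ₗ R.subtype
    have hκ : ∀ x : R, (κ x).1 = k.1 x.1 := fun x => k1' x.1
    refine ⟨ModuleCat.ofHom κ, ?_, ?_⟩
    · apply ModuleCat.hom_ext
      refine LinearMap.ext fun x => Subtype.ext ?_
      change (κ (φ.hom x)).1 = x.1
      rw [hκ, ← hf, k3', heR]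
    · apply ModuleCat.hom_ext
      refine LinearMap.ext fun x => Subtype.ext ?_
      change (φ.hom (κ x)).1 = x.1
      rw [← hf, hκ, k4', heR]
  · intro φ
    exact hPBH (R.subtype ∘ₗ φ.hom)
  · intro X' α' hα'
    obtain ⟨ψ, hψ⟩ := hPBF X' α' hα'
    refine ⟨ModuleCat.ofHom (e.1.rangeRestrict ∘ₗ ψ), ?_⟩
    apply ModuleCat.hom_ext
    refine LinearMap.ext fun x => ?_
    exact (e.2 (ψ x)).trans (hψ x)

/-- Auslander, Theorem I.3.19.  Let `Λ` be a ring, `c` and `Y` be `Λ`-modules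
with `c` finitely presented, and `H ⊆ Hom_Λ(c, Y)` an `End_Λ(c)`-submodule (`End_Λ(c)` acting
by precomposition).  Then there exists, up to isomorphism, a unique right minimal morphism
`α : X ⟶ Y` in the category of all `Λ`-modules which is right determined by `c` and satisfies
`Im Hom_Λ(c, α) = H`. -/
theorem stmt_2 {Λ : Type u} [Ring Λ] (c Y : ModuleCat.{u} Λ)
    [Module.FinitePresentation Λ c]
    (H : Submodule (End c)ᵐᵒᵖ (c ⟶ Y)) :
    ∃ (X : ModuleCat.{u} Λ) (α : X ⟶ Y),
      (RightMinimal α ∧ RightDetermined α c ∧ ImHom c α = (H : Set (c ⟶ Y))) ∧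
      ∀ (X' : ModuleCat.{u} Λ) (α' : X' ⟶ Y),
        (RightMinimal α' ∧ RightDetermined α' c ∧ ImHom c α' = (H : Set (c ⟶ Y))) →
          ∃ φ : X' ≅ X, φ.hom ≫ α = α' := by
  obtain ⟨X, α, hmin, hH, hF⟩ := aux_main c Y H
  have hIm : ImHom c α = (H : Set (c ⟶ Y)) := by
    ext h
    constructor
    · rintro ⟨f, rfl⟩
      exact hH f
    · intro hh
      exact hF c h fun φ => H.smul_mem (MulOpposite.op φ) hh
  refine ⟨X, α, ⟨hmin, ?_, hIm⟩, ?_⟩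
  · intro X' α'
    constructor
    · rintro ⟨ψ, rfl⟩ φ
      exact ⟨φ ≫ ψ, Category.assoc _ _ _⟩
    · intro h
      refine hF X' α' fun φ => ?_
      obtain ⟨ψ, hψ⟩ := h φ
      rw [← hψ]
      exact hH ψ
  · rintro X' α' ⟨hmin', hdet', hIm'⟩
    obtain ⟨p, hp⟩ : FactorsThru α' α := hF X' α' fun φ => by
      have : φ ≫ α' ∈ ImHom c α' := ⟨φ, rfl⟩
      rw [hIm'] at this
      exact this
    obtain ⟨q, hq⟩ : FactorsThru α α' := (hdet' α).2 fun φ => by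
      have : φ ≫ α ∈ ImHom c α' := by rw [hIm']; exact hH φ
      exact this
    have h1 : IsIso (p ≫ q) := hmin' _ (by rw [Category.assoc, hq, hp])
    have h2 : IsIso (q ≫ p) := hmin _ (by rw [Category.assoc, hp, hq])
    have : IsSplitMono p := IsSplitMono.mk' ⟨q ≫ inv (p ≫ q), by
      rw [← Category.assoc, IsIso.hom_inv_id]⟩
    have : IsSplitEpi p := IsSplitEpi.mk' ⟨inv (q ≫ p) ≫ q, by
      rw [Category.assoc, IsIso.inv_hom_id]⟩
    have : IsIso p := isIso_of_epi_of_isSplitMono p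
    exact ⟨asIso p, hp⟩
end

section
/- Let C be a poset viewed as a category and let α : x → y be a morphism (i.e., x ≤ y). If x = y, then α is right determined by every object of C. If x ≠ y, then for an object c of C, the morphism α is right determined by c if and only if c is the least element of the set C_α = {c ∈ C : c ≰ x and c ≤ y} (i.e., c ∈ C_α and c ≤ d for every d ∈ C_α). -/
open CategoryTheory CategoryTheory.Limits Opposite

universe v u

theorem rightDetermined_iff_aux {P : Type u} [PartialOrder P] {x y : P} (α : x ⟶ y) (c : P) :
    RightDetermined α c ↔ ∀ z : P, z ≤ y → (z ≤ x ↔ (c ≤ z → c ≤ x)) := by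
  have key : ∀ {z : P} (β : z ⟶ y), FactorsThru β α ↔ z ≤ x := fun β =>
    ⟨fun ⟨φ, _⟩ => leOfHom φ, fun h => ⟨homOfLE h, Subsingleton.elim _ _⟩⟩
  unfold RightDetermined
  simp only [key]
  exact ⟨fun h z hz => (h (homOfLE hz)).trans
      ⟨fun g hc => g (homOfLE hc), fun g φ => g (leOfHom φ)⟩,
    fun h z β => (h z (leOfHom β)).trans
      ⟨fun g φ => g (leOfHom φ), fun g hc => g (homOfLE hc)⟩⟩

/-- Let `P` be a poset viewed as a category and `α : x ⟶ y` a morphism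
(i.e. `x ≤ y`).  If `x = y` then `α` is right determined by every object.  If `x ≠ y`, then
`α` is right determined by `c` iff `c` is the least element of
`{c | ¬ c ≤ x ∧ c ≤ y}`. -/
theorem stmt_3 {P : Type u} [PartialOrder P] {x y : P} (α : x ⟶ y) :
    (x = y → ∀ c : P, RightDetermined α c) ∧
    (x ≠ y → ∀ c : P,
      (RightDetermined α c ↔
        ((¬ c ≤ x ∧ c ≤ y) ∧ ∀ d : P, (¬ d ≤ x ∧ d ≤ y) → c ≤ d))) := by
  simp only [rightDetermined_iff_aux]
  have hxy : x ≤ y := leOfHom α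
  refine ⟨?_, ?_⟩
  · rintro rfl c z hz
    exact ⟨fun h hc => hc.trans h, fun _ => hz⟩
  · intro hne c
    have hyx : ¬ y ≤ x := fun h => hne (le_antisymm hxy h)
    constructor
    · intro h
      have h1 := h y le_rfl
      refine ⟨by tauto, fun d hd => ?_⟩
      have h2 := h d hd.2
      tauto
    · rintro ⟨⟨h1, h2⟩, h3⟩ z hz
      refine ⟨fun h hc => hc.trans h, fun h => ?_⟩
      by_contra hzx
      exact h1 (h (h3 z ⟨hzx, hz⟩))
end

section
/- Let C be a k-linear Hom-finite essentially small idempotent complete additive category over a commutative artinian ring k, fix an object C of C and set Γ = End_C(C). Let α : X → Y be a morphism in C such that there is an exact sequence of functors Hom_C(−, X) → Hom_C(−, Y) → coind_C(I) for some finitely presented Γ-module I, where the first map is composition with α and the second is any natural transformation making the sequence exact. Then α is right determined by C. -/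
open CategoryTheory CategoryTheory.Limits Opposite

universe v u

/-- `E` is an injective envelope of `k/𝔯` over `k`, where `𝔯` is the Jacobson radical of `k`:
`E` is an injective `k`-module and there is an injective `k`-linear map
`k/𝔯 →ₗ[k] E` whose image is an essential submodule of `E`. -/
def IsInjectiveEnvelopeOfResidueField (k : Type v) [CommRing k]
    (E : Type v) [AddCommGroup E] [Module k E] : Prop :=
  Module.Injective k E ∧
    ∃ i : (k ⧸ (⊥ : Ideal k).jacobson) →ₗ[k] E,
      Function.Injective i ∧
      ∀ N : Submodule k E, N ≠ ⊥ → N ⊓ LinearMap.range i ≠ ⊥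

section LinearCategory

variable {k : Type v} [CommRing k]
variable {C : Type u} [Category.{v} C] [Preadditive C] [Linear k C]

/-- Postcomposition with `f : X ⟶ Y` as a map of modules over `Γ = (End c)ᵐᵒᵖ`
(where `Γ` acts by precomposition). -/
def postCompGamma (c : C) {X Y : C} (f : X ⟶ Y) :
    (c ⟶ X) →ₗ[(End c)ᵐᵒᵖ] (c ⟶ Y) where
  toFun g := g ≫ f
  map_add' g h := Preadditive.add_comp _ _ _ _ _ _
  map_smul' γ g := by
    show (γ.unop ≫ g) ≫ f = γ.unop ≫ (g ≫ f)
    simp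

variable (k) in
/-- The underlying `k`-linear map of `γ • (−) : Hom_k(Γ, E) → Hom_k(Γ, E)`,
namely `φ ↦ (x ↦ φ (x * γ))`. -/
def dualRegularSmul {c : C} (E : Type v) [AddCommGroup E] [Module k E]
    (γ : (End c)ᵐᵒᵖ) (φ : (End c)ᵐᵒᵖ →ₗ[k] E) : (End c)ᵐᵒᵖ →ₗ[k] E where
  toFun x := φ (x * γ)
  map_add' x y := by
    show φ ((x + y) * γ) = φ (x * γ) + φ (y * γ)
    rw [add_mul, map_add]
  map_smul' a x := by
    show φ ((a • x) * γ) = a • φ (x * γ)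
    rw [smul_mul_assoc, map_smul]

/-- The left `Γ`-module structure on `D Γ = Hom_k(Γ, E)` for `Γ = (End c)ᵐᵒᵖ`, given by
`(γ • φ) x = φ (x * γ)`; this is `D` applied to the right regular representation. -/
instance dualRegularModule (c : C) (E : Type v) [AddCommGroup E] [Module k E] :
    Module (End c)ᵐᵒᵖ ((End c)ᵐᵒᵖ →ₗ[k] E) where
  smul γ φ := dualRegularSmul k E γ φ
  one_smul φ := by ext x; show φ (x * 1) = φ x; rw [mul_one]
  mul_smul γ₁ γ₂ φ := by
    ext x; show φ (x * (γ₁ * γ₂)) = φ (x * γ₁ * γ₂); rw [mul_assoc]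
  smul_zero γ := by ext x; rfl
  smul_add γ φ ψ := by ext x; rfl
  add_smul γ₁ γ₂ φ := by
    ext x; show φ (x * (γ₁ + γ₂)) = φ (x * γ₁) + φ (x * γ₂); rw [mul_add, map_add]
  zero_smul φ := by ext x; show φ (x * 0) = 0; rw [mul_zero, map_zero]

instance dualRegularSMulCommClass (c : C) (E : Type v) [AddCommGroup E] [Module k E] :
    SMulCommClass (End c)ᵐᵒᵖ k ((End c)ᵐᵒᵖ →ₗ[k] E) where
  smul_comm γ a φ := by
    ext x
    show (a • φ) (x * γ) = a • (φ (x * γ))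
    simp

end LinearCategory
/-- Lemma `le:det`.  Fix `c : C` and `Γ = End_C(c)` (acting on `Hom(c, −)`
by precomposition, encoded as `(End c)ᵐᵒᵖ`).  Let `α : X ⟶ Y` be a morphism of `C` and suppose
there is an exact sequence of functors
`Hom_C(−, X) → Hom_C(−, Y) → coind_c I = Hom_Γ(Hom_C(c, −), I)`
for some finitely presented `Γ`-module `I`, the first map being composition with `α` and the
second a natural transformation `η` (exactness checked on every object).  Then `α` is right
determined by `c`. -/
theorem stmt_8 {k : Type v} [CommRing k] [IsArtinianRing k]
    {C : Type u} [Category.{v} C] [Preadditive C] [Linear k C]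
    [EssentiallySmall.{v} C] [IsIdempotentComplete C]
    (homFinite : ∀ A B : C, IsFiniteLength k (A ⟶ B))
    (c : C) (I : Type v) [AddCommGroup I] [Module (End c)ᵐᵒᵖ I]
    [Module k I] [SMulCommClass (End c)ᵐᵒᵖ k I]
    [Module.FinitePresentation (End c)ᵐᵒᵖ I]
    {X Y : C} (α : X ⟶ Y)
    (η : ∀ A : C, (A ⟶ Y) →ₗ[k] ((c ⟶ A) →ₗ[(End c)ᵐᵒᵖ] I))
    (hnat : ∀ ⦃B A : C⦄ (f : B ⟶ A) (g : A ⟶ Y) (u : c ⟶ B),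
      η B (f ≫ g) u = η A g (u ≫ f))
    (hexact : ∀ A : C, Function.Exact (fun h : A ⟶ X => h ≫ α) (η A)) :
    RightDetermined α c := by
  intro X' α'
  constructor
  · rintro ⟨h, rfl⟩ φ
    exact ⟨φ ≫ h, by simp⟩
  · intro H
    refine (hexact X' α').1 ?_
    ext u
    have h1 : η c (u ≫ α') = 0 := (hexact c (u ≫ α')).2 (H u)
    have h2 := hnat u α' (𝟙 c)
    rw [h1, Category.id_comp] at h2
    exact h2.symm
end

section
/- Let C be a k-linear Hom-finite essentially small idempotent complete additive category over a commutative artinian ring k, with duality D = Hom_k(−, E(k/𝔯)). Let α : X → Y be a morphism in C and suppose there is an exact sequence of functors Hom_C(−, X) → Hom_C(−, Y) → D Hom_C(C, −) for some object C of C, where the first map is composition with α. Then α is right determined by C. -/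
open CategoryTheory CategoryTheory.Limits Opposite

universe v u

/-- Proposition `pr:det-obj`.  Let `α : X ⟶ Y` be a morphism of `C` and
suppose there is an exact sequence of functors
`Hom_C(−, X) → Hom_C(−, Y) → D Hom_C(c, −)`
for some object `c`, the first map being composition with `α` and the second a natural
transformation `η` (exactness checked on every object).  Then `α` is right determined
by `c`. -/
theorem stmt_9 {k : Type v} [CommRing k] [IsArtinianRing k]
    (E : Type v) [AddCommGroup E] [Module k E]
    (hE : IsInjectiveEnvelopeOfResidueField k E)
    {C : Type u} [Category.{v} C] [Preadditive C] [Linear k C]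
    [EssentiallySmall.{v} C] [IsIdempotentComplete C]
    (homFinite : ∀ A B : C, IsFiniteLength k (A ⟶ B))
    (c : C) {X Y : C} (α : X ⟶ Y)
    (η : ∀ A : C, (A ⟶ Y) →ₗ[k] ((c ⟶ A) →ₗ[k] E))
    (hnat : ∀ ⦃B A : C⦄ (f : B ⟶ A) (g : A ⟶ Y) (u : c ⟶ B),
      η B (f ≫ g) u = η A g (u ≫ f))
    (hexact : ∀ A : C, Function.Exact (fun h : A ⟶ X => h ≫ α) (η A)) :
    RightDetermined α c := by
  intro X' α'
  constructor
  · rintro ⟨ψ, rfl⟩ φ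
    exact ⟨φ ≫ ψ, Category.assoc _ _ _⟩
  · intro h
    refine (hexact X' α').1 ?_
    ext φ
    have h0 : η c (φ ≫ α') = 0 := (hexact c _).2 (h φ)
    have h1 := hnat φ α' (𝟙 c)
    rw [h0, Category.id_comp] at h1
    simpa using h1.symm
end

section
/- Let C be a k-linear Hom-finite essentially small idempotent complete additive category over a commutative artinian ring k. Given any morphism α : X → Y in C, there is a direct sum decomposition X = X' ⊕ X'' such that the restriction of α to X' is right minimal and the restriction of α to X'' is zero. -/
open CategoryTheory CategoryTheory.Limits Opposite

universe v u

attribute [local instance] CategoryTheory.Limits.hasBinaryBiproducts_of_finite_biproducts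

/-- Remark `re:min`.  Let `C` be a `k`-linear Hom-finite essentially small
idempotent complete additive category over a commutative artinian ring `k`.  Any morphism
`α : X ⟶ Y` admits a decomposition `X = X' ⊞ X''` such that `α` restricted to `X'` is right
minimal and `α` restricted to `X''` is zero. -/
theorem stmt_12 {k : Type v} [CommRing k] [IsArtinianRing k]
    {C : Type u} [Category.{v} C] [Preadditive C] [Linear k C] [HasFiniteBiproducts C]
    [EssentiallySmall.{v} C] [IsIdempotentComplete C]
    (homFinite : ∀ A B : C, IsFiniteLength k (A ⟶ B))
    {X Y : C} (α : X ⟶ Y) :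
    ∃ (X' X'' : C) (e : X ≅ X' ⊞ X''),
      RightMinimal (biprod.inl ≫ e.inv ≫ α) ∧ biprod.inr ≫ e.inv ≫ α = 0 := by
  have hA : ∀ A B : C, IsNoetherian k (A ⟶ B) ∧ IsArtinian k (A ⟶ B) := fun A B =>
    isFiniteLength_iff_isNoetherian_isArtinian.1 (homFinite A B)
  let S : Set (Submodule k (X ⟶ X)) :=
    {M | ∃ e : X ⟶ X, e ≫ e = e ∧ e ≫ α = α ∧ M = LinearMap.range (Linear.rightComp k X e)}
  have := (hA X X).2
  obtain ⟨M, ⟨e, he, heα, rfl⟩, hmin⟩ :=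
    WellFounded.has_min (wellFounded_lt (α := Submodule k (X ⟶ X))) S
      ⟨_, 𝟙 X, by simp, by simp, rfl⟩
  obtain ⟨X', i, p, hip, hpi⟩ := IsIdempotentComplete.idempotents_split X e he
  obtain ⟨X'', j, q, hjq, hqj⟩ := IsIdempotentComplete.idempotents_split X (𝟙 X - e)
    (by simp [he])
  have hie : i ≫ e = i := by rw [← hpi, ← Category.assoc, hip, Category.id_comp]
  have hep : e ≫ p = p := by rw [← hpi, Category.assoc, hip, Category.comp_id]
  have hje : j ≫ e = 0 := by
    have h1 : j ≫ (𝟙 X - e) = j := by rw [← hqj, ← Category.assoc, hjq, Category.id_comp]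
    simpa using h1
  have heq : e ≫ q = 0 := by
    have h1 : (𝟙 X - e) ≫ q = q := by rw [← hqj, Category.assoc, hjq, Category.comp_id]
    simpa using h1
  have hiq : i ≫ q = 0 := by rw [← hie, Category.assoc, heq, comp_zero]
  have hjp : j ≫ p = 0 := by rw [← hep, ← Category.assoc, hje, zero_comp]
  refine ⟨X', X'', ⟨biprod.lift p q, biprod.desc i j, ?_, ?_⟩, ?_, ?_⟩
  · rw [biprod.lift_desc, hpi, hqj]; abel
  · ext <;> simp [hip, hjq, hiq, hjp]
  · simp only [biprod.inl_desc_assoc]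
    intro φ hφ
    have := (hA X' X').1
    have := (hA X' X').2
    let ρ := Linear.rightComp k X' φ
    have hpow : ∀ n : ℕ, ∃ ψ : X' ⟶ X', (∀ f : X' ⟶ X', (ρ ^ n) f = f ≫ ψ) ∧
        ψ ≫ i ≫ α = i ≫ α := by
      intro n
      induction n with
      | zero => exact ⟨𝟙 _, by simp, by simp⟩
      | succ n ih =>
        obtain ⟨ψ, h1, h2⟩ := ih
        refine ⟨ψ ≫ φ, fun f => ?_, by rw [Category.assoc, hφ, h2]⟩
        rw [pow_succ', Module.End.mul_apply, h1]
        simp [ρ]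
    obtain ⟨n, hn⟩ := Filter.eventually_atTop.1 ρ.eventually_isCompl_ker_pow_range_pow
    have hc := hn (n + 1) (by omega)
    obtain ⟨χ, hχ, -⟩ := hpow n
    obtain ⟨ψ, hψ, hψα⟩ := hpow (n + 1)
    have hψχ : ψ = χ ≫ φ := by
      have h1 := hψ (𝟙 _)
      rw [pow_succ', Module.End.mul_apply, hχ] at h1
      simpa [ρ] using h1.symm
    have hdis : ∀ f g : X' ⟶ X', f = g ≫ ψ → f ≫ ψ = 0 → f = 0 := by
      intro f g h1 h2
      have := Submodule.disjoint_def.1 hc.disjoint f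
      exact this (by rw [LinearMap.mem_ker, hψ, h2]) ⟨g, by rw [hψ, h1]⟩
    obtain ⟨a, ha, c, ⟨b, hb⟩, hac⟩ := Submodule.mem_sup.1
      (hc.sup_eq_top ▸ Submodule.mem_top : (𝟙 X' : X' ⟶ X') ∈ _)
    rw [LinearMap.mem_ker, hψ] at ha
    rw [hψ] at hb
    have hca : c ≫ a = 0 := by
      apply hdis _ (b - c ≫ b) _ (by rw [Category.assoc, ha, comp_zero])
      have : a = 𝟙 _ - c := by rw [← hac]; abel
      rw [this]
      simp [← hb]
    have hcc : c ≫ c = c := by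
      have : c ≫ (a + c) = c := by rw [hac, Category.comp_id]
      simpa [hca] using this
    have haα : a ≫ i ≫ α = 0 := by
      rw [← hψα, ← Category.assoc, ha, zero_comp]
    have hcα : c ≫ i ≫ α = i ≫ α := by
      have : (a + c) ≫ i ≫ α = i ≫ α := by rw [hac, Category.id_comp]
      rwa [Preadditive.add_comp, haα, zero_add] at this
    have hle : LinearMap.range (Linear.rightComp k X (p ≫ c ≫ i)) ≤
        LinearMap.range (Linear.rightComp k X e) := by
      rintro _ ⟨f, rfl⟩
      exact ⟨f ≫ p ≫ c ≫ i, by simp [hie]⟩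
    have hnlt := hmin _ ⟨p ≫ c ≫ i, by simp [reassoc_of% hip, reassoc_of% hcc],
      by rw [Category.assoc, Category.assoc, hcα, ← Category.assoc, hpi, heα], rfl⟩
    have hge := hle.eq_or_lt.resolve_right hnlt
    have hmem : e ∈ LinearMap.range (Linear.rightComp k X e) := ⟨𝟙 _, by simp⟩
    rw [← hge] at hmem
    obtain ⟨f, hf⟩ := hmem
    replace hf : f ≫ p ≫ c ≫ i = e := hf
    have h1 : (i ≫ f ≫ p) ≫ c = 𝟙 _ := by
      have : i ≫ (f ≫ p ≫ c ≫ i) ≫ p = 𝟙 _ := by rw [hf, hep, hip]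
      simpa [hip] using this
    have hc1 : c = 𝟙 _ := by
      rw [← h1]
      nth_rw 1 [← Category.id_comp c]
      rw [← h1, Category.assoc, hcc]
    have hb' : (b ≫ χ) ≫ φ = 𝟙 _ := by rw [Category.assoc, ← hψχ, hb, hc1]
    have hsurj : Function.Surjective ρ := fun f => ⟨f ≫ b ≫ χ, by
      change (f ≫ b ≫ χ) ≫ φ = f
      rw [Category.assoc, hb', Category.comp_id]⟩
    have hinj := IsNoetherian.injective_of_surjective_endomorphism ρ hsurj
    refine ⟨b ≫ χ, hinj ?_, hb'⟩
    change (φ ≫ b ≫ χ) ≫ φ = 𝟙 _ ≫ φ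
    rw [Category.assoc, hb', Category.comp_id, Category.id_comp]
  · simp only [biprod.inr_desc_assoc]
    rw [← heα, ← Category.assoc, hje, zero_comp]
end

section
/- Let C be a k-linear, Hom-finite, essentially small, idempotent complete triangulated category over a commutative artinian ring k. Consider the conditions: (1) C admits a right Serre functor S : C → C; (2) given objects C, Y of C and an End_C(C)-submodule H ⊆ Hom_C(C, Y), there is a right C-determined morphism α : X → Y with Im Hom_C(C, α) = H; (3) every morphism in C is left determined by some object of C. Then (1) ⟺ (2), and (1) ⟹ (3). -/
open CategoryTheory CategoryTheory.Limits Opposite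

universe v u

section Serre

variable (k : Type v) [CommRing k] (E : Type v) [AddCommGroup E] [Module k E]
variable {C : Type u} [Category.{v} C] [Preadditive C] [Linear k C]

/-- `S` is a right Serre functor: there are `k`-linear isomorphisms
`D Hom_C(X, Y) = Hom_k(Hom_C(X, Y), E) ≅ Hom_C(Y, S X)`, natural in both variables. -/
def IsRightSerreFunctor (S : C ⥤ C) : Prop :=
  S.Additive ∧
  ∃ e : ∀ X Y : C, ((X ⟶ Y) →ₗ[k] E) ≃ₗ[k] (Y ⟶ S.obj X),
    (∀ ⦃X Y' Y : C⦄ (f : Y' ⟶ Y) (ψ : (X ⟶ Y) →ₗ[k] E),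
      e X Y' (ψ.comp (Linear.rightComp k X f)) = f ≫ e X Y ψ) ∧
    (∀ ⦃X X' Y : C⦄ (u : X ⟶ X') (ψ : (X ⟶ Y) →ₗ[k] E),
      e X' Y (ψ.comp (Linear.leftComp k Y u)) = e X Y ψ ≫ S.map u)

variable (C) in
/-- `C` admits a right Serre functor. -/
def HasRightSerreFunctor : Prop :=
  ∃ S : C ⥤ C, IsRightSerreFunctor k E S

variable (C) in
/-- `C` admits a Serre functor, i.e. a right Serre functor which is an equivalence. -/
def HasSerreFunctor : Prop :=
  ∃ S : C ⥤ C, S.IsEquivalence ∧ IsRightSerreFunctor k E S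

end Serre
section Helpers

theorem aux_ext_s15 {k : Type v} [CommRing k] {E : Type v} [AddCommGroup E] [Module k E]
    (hE : Module.Injective k E) {P P' : Type v} [AddCommGroup P] [Module k P]
    [AddCommGroup P'] [Module k P'] (f : P →ₗ[k] P') (g : P →ₗ[k] E)
    (h : ∀ x, f x = 0 → g x = 0) : ∃ h : P' →ₗ[k] E, ∀ x, h (f x) = g x := by
  have hk : LinearMap.ker f ≤ LinearMap.ker g := fun x hx => h x hx
  obtain ⟨l, hl⟩ := Module.Injective.out ((LinearMap.ker f).liftQ f le_rfl)
    (by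
      rw [← LinearMap.ker_eq_bot]
      exact Submodule.ker_liftQ_eq_bot _ _ _ le_rfl) ((LinearMap.ker f).liftQ g hk)
  refine ⟨l, fun x => ?_⟩
  simpa using hl (Submodule.Quotient.mk x)

theorem aux_elt {k : Type v} [CommRing k] [IsArtinianRing k] (m : Ideal k) (hm : m.IsMaximal) :
    ∃ a : k, a ∉ (⊥ : Ideal k).jacobson ∧ ∀ r ∈ m, r * a ∈ (⊥ : Ideal k).jacobson := by
  classical
  have hfin : {I : Ideal k | I.IsMaximal}.Finite := IsArtinianRing.setOfPred_isMaximal_finite k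
  have hmem : ∀ x : k, (∀ J : Ideal k, J.IsMaximal → x ∈ J) → x ∈ (⊥ : Ideal k).jacobson := by
    intro x hx
    rw [Ideal.jacobson, Submodule.mem_sInf]
    exact fun J hJ => hx J hJ.2
  have hmem' : ∀ x : k, x ∈ (⊥ : Ideal k).jacobson → x ∈ m := by
    intro x hx
    rw [Ideal.jacobson, Submodule.mem_sInf] at hx
    exact hx m ⟨bot_le, hm⟩
  have h : ¬ ((hfin.toFinset.erase m).inf id ≤ m) := by
    intro h
    obtain ⟨J, hJ, hJm⟩ := (Ideal.IsPrime.inf_le' hm.isPrime).1 h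
    simp only [Finset.mem_erase, Set.Finite.mem_toFinset, Set.mem_ofPred_eq] at hJ
    exact hJ.1 (hJ.2.eq_of_le hm.ne_top hJm)
  obtain ⟨a, ha, ham⟩ := SetLike.not_le_iff_exists.1 h
  refine ⟨a, fun h => ham (hmem' a h), fun r hr => hmem _ fun J hJ => ?_⟩
  by_cases hJm : J = m
  · subst hJm; exact Ideal.mul_mem_right _ _ hr
  · refine Ideal.mul_mem_left _ _ ?_
    have : (hfin.toFinset.erase m).inf id ≤ J :=
      Finset.inf_le (f := id) (by simp [hJm, hJ])
    exact this ha

theorem aux_cogen {k : Type v} [CommRing k] [IsArtinianRing k]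
    {E : Type v} [AddCommGroup E] [Module k E]
    (hE : IsInjectiveEnvelopeOfResidueField k E) {M : Type v} [AddCommGroup M] [Module k M]
    (H : Submodule k M) (x : M) (hx : x ∉ H) :
    ∃ ψ : M →ₗ[k] E, (∀ y ∈ H, ψ y = 0) ∧ ψ x ≠ 0 := by
  obtain ⟨hinj, i, hi, -⟩ := hE
  let f : k →ₗ[k] (M ⧸ H) := LinearMap.toSpanSingleton k _ (H.mkQ x)
  have hf : LinearMap.ker f ≠ ⊤ := by
    intro h
    have : (1 : k) ∈ LinearMap.ker f := h ▸ Submodule.mem_top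
    apply hx
    simpa [f] using this
  obtain ⟨m, hm, hle⟩ := Ideal.exists_le_maximal (LinearMap.ker f) hf
  obtain ⟨a, ha, ham⟩ := aux_elt m hm
  obtain ⟨h, hh⟩ := aux_ext_s15 hinj f
    (i ∘ₗ (Submodule.mkQ (⊥ : Ideal k).jacobson) ∘ₗ LinearMap.toSpanSingleton k k a) (by
      intro r hr
      have := ham r (hle hr)
      simp only [LinearMap.comp_apply, LinearMap.toSpanSingleton_apply, smul_eq_mul]
      rw [Submodule.mkQ_apply, (Submodule.Quotient.mk_eq_zero _).2 this, map_zero])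
  refine ⟨h ∘ₗ H.mkQ, fun y hy => ?_, ?_⟩
  · rw [LinearMap.comp_apply, Submodule.mkQ_apply, (Submodule.Quotient.mk_eq_zero _).2 hy, map_zero]
  · have h1 := hh 1
    simp only [f, LinearMap.comp_apply, LinearMap.toSpanSingleton_apply, one_smul] at h1
    rw [LinearMap.comp_apply, h1]
    intro h0
    rw [← map_zero i] at h0
    exact ha ((Submodule.Quotient.mk_eq_zero _).1 (hi h0))

theorem aux_dual_noeth {k : Type v} [CommRing k] [IsArtinianRing k]
    {E : Type v} [AddCommGroup E] [Module k E]
    (hE : IsInjectiveEnvelopeOfResidueField k E) {M : Type v} [AddCommGroup M] [Module k M]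
    (hM : IsFiniteLength k M) : IsNoetherian k (M →ₗ[k] E) := by
  induction hM with
  | of_subsingleton => infer_instance
  | @of_simple_quotient M _ _ N hs hN ih =>
    have hq : IsNoetherian k ((M ⧸ N) →ₗ[k] E) := by
      obtain ⟨-, i, -, hess⟩ := hE
      have := IsSimpleModule.nontrivial k (M ⧸ N)
      obtain ⟨x, hx⟩ := exists_ne (0 : M ⧸ N)
      have hr : ∀ ψ : (M ⧸ N) →ₗ[k] E, ψ x ∈ LinearMap.range i := by
        intro ψ
        rcases eq_bot_or_eq_top (Submodule.comap ψ (LinearMap.range i)) with h | h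
        · have : LinearMap.range ψ = ⊥ := by
            by_contra hne
            apply hess _ hne
            rw [eq_bot_iff]
            rintro _ ⟨⟨z, rfl⟩, hz⟩
            have : z ∈ Submodule.comap ψ (LinearMap.range i) := hz
            rw [h, Submodule.mem_bot] at this
            simp [this]
          rw [LinearMap.range_eq_bot] at this
          simp [this]
        · have : x ∈ Submodule.comap ψ (LinearMap.range i) := h ▸ Submodule.mem_top
          exact this
      refine isNoetherian_of_injective
        (LinearMap.codRestrict (LinearMap.range i) (LinearMap.applyₗ x) hr) ?_
      rw [← LinearMap.ker_eq_bot, eq_bot_iff]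
      intro ψ hψ
      have h0 : ψ x = 0 := congrArg Subtype.val hψ
      have hk : LinearMap.ker ψ = ⊤ := by
        rcases eq_bot_or_eq_top (LinearMap.ker ψ) with h | h
        · exact absurd (by simpa [h] using (show x ∈ LinearMap.ker ψ from h0)) hx
        · exact h
      simpa using LinearMap.ker_eq_top.1 hk
    refine isNoetherian_of_range_eq_ker (LinearMap.lcomp k E N.mkQ)
      (LinearMap.lcomp k E N.subtype) ?_
    ext ψ
    constructor
    · rintro ⟨φ, rfl⟩
      ext y
      simp only [LinearMap.lcomp_apply, LinearMap.comp_apply, Submodule.subtype_apply,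
        Submodule.mkQ_apply, LinearMap.zero_apply]
      rw [(Submodule.Quotient.mk_eq_zero _).2 y.2, map_zero]
    · intro h
      refine ⟨N.liftQ ψ fun y hy => ?_, ?_⟩
      · exact LinearMap.congr_fun h ⟨y, hy⟩
      · ext y; rfl

section Cat

open Pretriangulated

variable {k : Type v} [CommRing k] [IsArtinianRing k]
    {E : Type v} [AddCommGroup E] [Module k E]
    {C : Type u} [Category.{v} C] [Preadditive C] [Linear k C]
    [HasZeroObject C] [HasShift C ℤ] [∀ n : ℤ, (shiftFunctor C n).Additive]
    [Pretriangulated C]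

/-- `Γ`-submodules are `k`-submodules. -/
def auxRestrict (k : Type v) [CommRing k] {C : Type u} [Category.{v} C] [Preadditive C]
    [Linear k C] {c Y : C} (H : Submodule (End c)ᵐᵒᵖ (c ⟶ Y)) : Submodule k (c ⟶ Y) where
  carrier := H
  add_mem' := H.add_mem
  zero_mem' := H.zero_mem
  smul_mem' r g hg := by
    have h := H.smul_mem (MulOpposite.op (r • 𝟙 c : c ⟶ c)) hg
    have h2 : (MulOpposite.op (r • 𝟙 c : c ⟶ c) : (End c)ᵐᵒᵖ) • g = r • g := by
      rw [endOpModule_smul_def]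
      show (r • 𝟙 c : c ⟶ c) ≫ g = _
      simp
    rw [h2] at h
    exact h

theorem aux_12 (hE : IsInjectiveEnvelopeOfResidueField k E)
    (homFinite : ∀ A B : C, IsFiniteLength k (A ⟶ B)) (hS : HasRightSerreFunctor k E C)
    (c Y : C) (H : Submodule (End c)ᵐᵒᵖ (c ⟶ Y)) :
    ∃ (X : C) (α : X ⟶ Y), RightDetermined α c ∧ ImHom c α = (H : Set (c ⟶ Y)) := by
  obtain ⟨S, -, e, he, -⟩ := hS
  -- annihilator of `H`
  let P : Submodule k ((c ⟶ Y) →ₗ[k] E) :=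
    { carrier := {ψ | ∀ g ∈ H, ψ g = 0}
      add_mem' := fun ha hb g hg => by simp [ha g hg, hb g hg]
      zero_mem' := fun g _ => rfl
      smul_mem' := fun r a ha g hg => by simp [ha g hg] }
  have := aux_dual_noeth hE (homFinite c Y)
  obtain ⟨n, s, hs⟩ := Submodule.fg_iff_exists_fin_generating_family.1 (IsNoetherian.noetherian P)
  let β : Y ⟶ ⨁ (fun _ : Fin n => S.obj c) := biproduct.lift fun j => e c Y (s j)
  obtain ⟨X, α, δ, hT⟩ := distinguished_cocone_triangle₁ β
  have key : ∀ ⦃X' : C⦄ (α' : X' ⟶ Y), FactorsThru α' α ↔ ∀ φ : c ⟶ X', φ ≫ α' ∈ H := by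
    intro X' α'
    have h1 : FactorsThru α' α ↔ α' ≫ β = 0 := by
      constructor
      · rintro ⟨φ, rfl⟩
        have hz : α ≫ β = 0 := comp_distTriang_mor_zero₁₂ _ hT
        rw [Category.assoc, hz, comp_zero]
      · intro h
        obtain ⟨φ, hφ⟩ := Triangle.coyoneda_exact₂ _ hT α' h
        exact ⟨φ, hφ.symm⟩
    have h2 : α' ≫ β = 0 ↔ ∀ ψ ∈ P, α' ≫ e c Y ψ = 0 := by
      constructor
      · intro h
        have : P ≤ LinearMap.ker ((Linear.leftComp k (S.obj c) α') ∘ₗ (e c Y).toLinearMap) := by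
          rw [← hs, Submodule.span_le]
          rintro _ ⟨j, rfl⟩
          have := congrArg (· ≫ biproduct.π _ j) h
          simpa [β] using this
        exact fun ψ hψ => this hψ
      · intro h
        apply biproduct.hom_ext
        intro j
        have := h (s j) (hs ▸ Submodule.subset_span ⟨j, rfl⟩)
        simpa [β] using this
    rw [h1, h2]
    have h3 : ∀ ψ, α' ≫ e c Y ψ = 0 ↔ ∀ φ : c ⟶ X', ψ (φ ≫ α') = 0 := by
      intro ψ
      rw [← he, LinearEquiv.map_eq_zero_iff]
      exact ⟨fun h φ => LinearMap.congr_fun h φ, fun h => LinearMap.ext h⟩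
    simp only [h3]
    constructor
    · intro h φ
      by_contra hn
      obtain ⟨ψ, hψ, hne⟩ := aux_cogen hE (auxRestrict k H) (φ ≫ α') hn
      exact hne (h ψ hψ φ)
    · exact fun h ψ hψ φ => hψ _ (h φ)
  have key2 : ∀ g : c ⟶ Y, FactorsThru g α ↔ g ∈ H := by
    intro g
    rw [key]
    constructor
    · intro h; simpa using h (𝟙 c)
    · intro h φ
      exact H.smul_mem (MulOpposite.op (φ : End c)) h
  refine ⟨X, α, ?_, ?_⟩
  · intro X' α'
    simp only [key2]
    exact key α'
  · ext g
    exact key2 g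

theorem aux_13 (hE : IsInjectiveEnvelopeOfResidueField k E)
    (hS : HasRightSerreFunctor k E C) {X Y : C} (α : X ⟶ Y) : ∃ c : C, LeftDetermined α c := by
  obtain ⟨S, -, e, he, -⟩ := hS
  obtain ⟨W, w, δ, hT⟩ := distinguished_cocone_triangle₁ α
  have hz : w ≫ α = 0 := comp_distTriang_mor_zero₁₂ _ hT
  refine ⟨S.obj W, ?_⟩
  intro Y' α'
  constructor
  · rintro ⟨φ, rfl⟩ ψ
    exact ⟨ψ ≫ φ, by simp⟩
  · intro h
    have h0 : w ≫ α'.unop = 0 := by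
      by_contra hne
      obtain ⟨ψ, -, hψ⟩ := aux_cogen hE (⊥ : Submodule k (W ⟶ Y'.unop)) (w ≫ α'.unop)
        (by simpa using hne)
      obtain ⟨φ, hφ⟩ := h (e W Y'.unop ψ).op
      have h1 : α'.unop ≫ e W Y'.unop ψ = α ≫ φ.unop := by
        have := congrArg Quiver.Hom.unop hφ
        simpa using this.symm
      have h2 : (w ≫ α'.unop) ≫ e W Y'.unop ψ = 0 := by
        rw [Category.assoc, h1, ← Category.assoc, hz, zero_comp]
      rw [← he, LinearEquiv.map_eq_zero_iff] at h2
      have h3 := LinearMap.congr_fun h2 (𝟙 W)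
      apply hψ
      simpa using h3
    obtain ⟨g, hg⟩ := Triangle.yoneda_exact₂ _ hT α'.unop h0
    refine ⟨g.op, ?_⟩
    apply Quiver.Hom.unop_inj
    exact hg.symm

theorem aux_A (hE : Module.Injective k E)
    (h2 : ∀ (c Y : C) (H : Submodule (End c)ᵐᵒᵖ (c ⟶ Y)),
        ∃ (X : C) (α : X ⟶ Y), RightDetermined α c ∧ ImHom c α = (H : Set (c ⟶ Y)))
    (X B : C) (b : (X ⟶ B) →ₗ[k] E) :
    ∃ (Z : C) (β : B ⟶ Z) (b' : (X ⟶ Z) →ₗ[k] E), (∀ g, b' (g ≫ β) = b g) ∧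
      ∀ ⦃T : C⦄ (f : T ⟶ B), f ≫ β = 0 ↔ ∀ φ : X ⟶ T, b (φ ≫ f) = 0 := by
  let H : Submodule (End X)ᵐᵒᵖ (X ⟶ B) :=
    { carrier := {g | ∀ γ : X ⟶ X, b (γ ≫ g) = 0}
      add_mem' := fun {p q} hp hq γ => by rw [Preadditive.comp_add, map_add, hp γ, hq γ, add_zero]
      zero_mem' := fun γ => by simp
      smul_mem' := fun r p hp γ => by
        have := hp (γ ≫ r.unop)
        rw [Category.assoc] at this
        exact this }
  obtain ⟨A, α, hdet, him⟩ := h2 X B H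
  obtain ⟨Z, β, δ, hT⟩ := distinguished_cocone_triangle α
  have hz : α ≫ β = 0 := comp_distTriang_mor_zero₁₂ _ hT
  have key : ∀ ⦃T : C⦄ (f : T ⟶ B), f ≫ β = 0 ↔ ∀ φ : X ⟶ T, b (φ ≫ f) = 0 := by
    intro T f
    have h1 : FactorsThru f α ↔ f ≫ β = 0 := by
      constructor
      · rintro ⟨φ, rfl⟩
        rw [Category.assoc, hz, comp_zero]
      · intro h
        obtain ⟨φ, hφ⟩ := Triangle.coyoneda_exact₂ _ hT f h
        exact ⟨φ, hφ.symm⟩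
    have h3 : ∀ g : X ⟶ B, FactorsThru g α ↔ ∀ γ : X ⟶ X, b (γ ≫ g) = 0 := by
      intro g
      exact Set.ext_iff.1 him g
    rw [← h1, hdet]
    simp only [h3]
    constructor
    · intro h φ
      simpa using h φ (𝟙 X)
    · intro h φ γ
      simpa using h (γ ≫ φ)
  obtain ⟨b', hb'⟩ := aux_ext_s15 hE (Linear.rightComp k X β) b (by
    intro g hg
    simpa using (key g).1 hg (𝟙 X))
  exact ⟨Z, β, b', hb', key⟩

theorem aux_epi (hE : IsInjectiveEnvelopeOfResidueField k E)
    (homFinite : ∀ A B : C, IsFiniteLength k (A ⟶ B))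
    (h2 : ∀ (c Y : C) (H : Submodule (End c)ᵐᵒᵖ (c ⟶ Y)),
        ∃ (X : C) (α : X ⟶ Y), RightDetermined α c ∧ ImHom c α = (H : Set (c ⟶ Y)))
    (X : C) :
    ∃ (B : C) (b : (X ⟶ B) →ₗ[k] E), ∀ ⦃Z : C⦄ (z : (X ⟶ Z) →ₗ[k] E),
      ∃ f : Z ⟶ B, ∀ φ, b (φ ≫ f) = z φ := by
  have := aux_dual_noeth hE (homFinite X X)
  obtain ⟨n, s, hs⟩ := Submodule.fg_iff_exists_fin_generating_family.1
    (IsNoetherian.noetherian (⊤ : Submodule k ((X ⟶ X) →ₗ[k] E)))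
  let Y : C := ⨁ (fun _ : Fin n => X)
  let b : (X ⟶ Y) →ₗ[k] E := ∑ j, (s j) ∘ₗ Linear.rightComp k X (biproduct.π _ j)
  have hb : ∀ ξ : (X ⟶ X) →ₗ[k] E, ∃ g : X ⟶ Y, ∀ γ, b (γ ≫ g) = ξ γ := by
    intro ξ
    have hξ : ξ ∈ Submodule.span k (Set.range s) := hs ▸ Submodule.mem_top
    obtain ⟨t, ht⟩ := (Submodule.mem_span_range_iff_exists_fun k).1 hξ
    refine ⟨biproduct.lift fun j => t j • 𝟙 X, fun γ => ?_⟩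
    rw [← ht]
    simp [b]
  obtain ⟨W, β, b', hb', key⟩ := aux_A hE.1 h2 X Y b
  refine ⟨W, b', fun Z z => ?_⟩
  have hnZ := (isFiniteLength_iff_isNoetherian_isArtinian.1 (homFinite X Z)).1
  obtain ⟨m, φ, hφ⟩ := Submodule.fg_iff_exists_fin_generating_family.1
    (hnZ.noetherian (⊤ : Submodule k (X ⟶ Z)))
  choose g hg using fun j => hb (z ∘ₗ Linear.rightComp k X (φ j))
  let Φ : (⨁ (fun _ : Fin m => X)) ⟶ Z := biproduct.desc φ
  let G : (⨁ (fun _ : Fin m => X)) ⟶ Y := biproduct.desc g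
  have hG : ∀ l : X ⟶ (⨁ (fun _ : Fin m => X)), b (l ≫ G) = z (l ≫ Φ) := by
    intro l
    have hl : l = ∑ j, (l ≫ biproduct.π _ j) ≫ biproduct.ι (fun _ : Fin m => X) j := by
      simp only [Category.assoc]
      rw [← Preadditive.comp_sum, biproduct.total, Category.comp_id]
    have e1 : l ≫ G = ∑ j, (l ≫ biproduct.π _ j) ≫ g j := by
      conv_lhs => rw [hl]
      rw [Preadditive.sum_comp]
      simp [G]
    have e2 : l ≫ Φ = ∑ j, (l ≫ biproduct.π _ j) ≫ φ j := by
      conv_lhs => rw [hl]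
      rw [Preadditive.sum_comp]
      simp [Φ]
    rw [e1, e2, map_sum, map_sum]
    refine Finset.sum_congr rfl fun j _ => ?_
    rw [hg]
    rfl
  obtain ⟨K, κ, δ, hT⟩ := distinguished_cocone_triangle₁ Φ
  have hz : κ ≫ Φ = 0 := comp_distTriang_mor_zero₁₂ _ hT
  have hK : κ ≫ (G ≫ β) = 0 := by
    rw [← Category.assoc, key]
    intro l
    rw [← Category.assoc, hG, Category.assoc, hz, comp_zero, map_zero]
  obtain ⟨f, hf⟩ : ∃ f : Z ⟶ W, G ≫ β = Φ ≫ f := Triangle.yoneda_exact₂ _ hT (G ≫ β) hK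
  refine ⟨f, ?_⟩
  have : b' ∘ₗ Linear.rightComp k X f = z := by
    refine LinearMap.ext_on_range (v := φ) (by rw [hφ]) fun j => ?_
    have e1 : biproduct.ι _ j ≫ Φ = φ j := by simp [Φ]
    show b' (φ j ≫ f) = z (φ j)
    rw [← e1, Category.assoc, ← hf, ← Category.assoc, hb', hG]
  exact fun l => LinearMap.congr_fun this l

theorem aux_rep [IsIdempotentComplete C] (hE : IsInjectiveEnvelopeOfResidueField k E)
    (homFinite : ∀ A B : C, IsFiniteLength k (A ⟶ B))
    (h2 : ∀ (c Y : C) (H : Submodule (End c)ᵐᵒᵖ (c ⟶ Y)),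
        ∃ (X : C) (α : X ⟶ Y), RightDetermined α c ∧ ImHom c α = (H : Set (c ⟶ Y)))
    (X : C) :
    ∃ (V : C) (b : (X ⟶ V) →ₗ[k] E), ∀ Z : C,
      Function.Bijective (fun f : Z ⟶ V => b ∘ₗ Linear.rightComp k X f) := by
  obtain ⟨B, b, hb⟩ := aux_epi hE homFinite h2 X
  obtain ⟨Z, β, b', hb', key⟩ := aux_A hE.1 h2 X B b
  have key2 : ∀ ⦃T : C⦄ (f g : T ⟶ B), (∀ φ, b (φ ≫ f) = b (φ ≫ g)) → f ≫ β = g ≫ β := by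
    intro T f g h
    rw [← sub_eq_zero, ← Preadditive.sub_comp, key]
    intro φ
    rw [Preadditive.comp_sub, map_sub, h, sub_self]
  obtain ⟨f, hf⟩ := hb b'
  have hp : ∀ g : X ⟶ Z, b' (g ≫ f ≫ β) = b' g := by
    intro g
    rw [← Category.assoc, hb', hf]
  have hpp : (f ≫ β) ≫ (f ≫ β) = f ≫ β := by
    have := key2 ((f ≫ β) ≫ f) f (fun φ => by
      rw [← Category.assoc, hf, hp, hf])
    simpa using this
  obtain ⟨V, i, r, hir, hri⟩ := IsIdempotentComplete.idempotents_split Z (f ≫ β) hpp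
  refine ⟨V, b' ∘ₗ Linear.rightComp k X i, fun T => ⟨?_, ?_⟩⟩
  · intro h₁ h₂ h
    have h' : ∀ φ, b' (φ ≫ h₁ ≫ i) = b' (φ ≫ h₂ ≫ i) := fun φ => by
      simpa using LinearMap.congr_fun h φ
    have h3 := key2 ((h₁ ≫ i) ≫ f) ((h₂ ≫ i) ≫ f) (fun φ => by
      rw [← Category.assoc φ (h₁ ≫ i) f, ← Category.assoc φ (h₂ ≫ i) f, hf, hf, h'])
    have h4 : ∀ h : T ⟶ V, (((h ≫ i) ≫ f) ≫ β) ≫ r = h := by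
      intro h
      rw [Category.assoc (h ≫ i), ← hri]
      simp [hir]
    rw [← h4 h₁, h3, h4]
  · intro z
    obtain ⟨g, hg⟩ := hb z
    refine ⟨g ≫ β ≫ r, ?_⟩
    ext φ
    show b' ((φ ≫ g ≫ β ≫ r) ≫ i) = z φ
    have : (φ ≫ g ≫ β ≫ r) ≫ i = ((φ ≫ g) ≫ β) ≫ f ≫ β := by
      rw [← hri]; simp
    rw [this, hp, hb', hg]

theorem aux_21 [IsIdempotentComplete C] (hE : IsInjectiveEnvelopeOfResidueField k E)
    (homFinite : ∀ A B : C, IsFiniteLength k (A ⟶ B))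
    (h2 : ∀ (c Y : C) (H : Submodule (End c)ᵐᵒᵖ (c ⟶ Y)),
        ∃ (X : C) (α : X ⟶ Y), RightDetermined α c ∧ ImHom c α = (H : Set (c ⟶ Y))) :
    HasRightSerreFunctor k E C := by
  choose V b hb using fun X : C => aux_rep hE homFinite h2 X
  let F : ∀ X Z : C, (Z ⟶ V X) →ₗ[k] ((X ⟶ Z) →ₗ[k] E) := fun X Z =>
    { toFun := fun f => b X ∘ₗ Linear.rightComp k X f
      map_add' := fun f g => by ext φ; simp
      map_smul' := fun r f => by ext φ; simp }
  let e : ∀ X Z : C, ((X ⟶ Z) →ₗ[k] E) ≃ₗ[k] (Z ⟶ V X) := fun X Z =>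
    (LinearEquiv.ofBijective (F X Z) (hb X Z)).symm
  have hFe : ∀ X Z ψ φ, b X (φ ≫ e X Z ψ) = ψ φ := by
    intro X Z ψ φ
    have : F X Z (e X Z ψ) = ψ := (LinearEquiv.ofBijective (F X Z) (hb X Z)).apply_symm_apply ψ
    exact LinearMap.congr_fun this φ
  have hinj : ∀ X Z (f g : Z ⟶ V X), (∀ φ, b X (φ ≫ f) = b X (φ ≫ g)) → f = g := by
    intro X Z f g h
    exact (hb X Z).1 (LinearMap.ext h)
  let M : ∀ {X X' : C} (u : X ⟶ X'), V X ⟶ V X' := fun {X X'} u =>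
    e X' (V X) (b X ∘ₗ Linear.leftComp k (V X) u)
  have hM : ∀ {X X' : C} (u : X ⟶ X') (φ : X' ⟶ V X), b X' (φ ≫ M u) = b X (u ≫ φ) := by
    intro X X' u φ
    rw [hFe]; rfl
  let S : C ⥤ C :=
    { obj := V
      map := fun u => M u
      map_id := fun X => hinj _ _ _ _ fun φ => by rw [hM]; simp
      map_comp := fun u v => hinj _ _ _ _ fun φ => by
        rw [hM, ← Category.assoc φ, hM, ← Category.assoc v, Category.assoc u, ← hM u] }
  refine ⟨S, ⟨?_⟩, e, ?_, ?_⟩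
  · intro X X' u v
    exact hinj _ _ _ _ fun φ => by
      show b X' (φ ≫ M (u + v)) = b X' (φ ≫ (M u + M v))
      rw [hM, Preadditive.comp_add, map_add, hM, hM, Preadditive.add_comp, map_add]
  · intro X Y' Y f ψ
    refine hinj _ _ _ _ fun φ => ?_
    rw [hFe, ← Category.assoc, hFe]; rfl
  · intro X X' Y u ψ
    refine hinj _ _ _ _ fun φ => ?_
    show _ = b X' (φ ≫ e X Y ψ ≫ M u)
    rw [hFe, ← Category.assoc, hM, ← Category.assoc, hFe]; rfl

end Cat

end Helpers

/-- Proposition `pr:main`.  For a `k`-linear Hom-finite essentially small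
idempotent complete triangulated category `C`, consider the conditions:
(1) `C` admits a right Serre functor;
(2) for all objects `c, Y` and every `End_C(c)`-submodule `H ⊆ Hom_C(c, Y)` there is a right
`c`-determined morphism `α : X ⟶ Y` with `Im Hom_C(c, α) = H`;
(3) every morphism of `C` is left determined by some object.
Then (1) ⟺ (2), and (1) ⟹ (3). -/
theorem stmt_15 {k : Type v} [CommRing k] [IsArtinianRing k]
    (E : Type v) [AddCommGroup E] [Module k E]
    (hE : IsInjectiveEnvelopeOfResidueField k E)
    {C : Type u} [Category.{v} C] [Preadditive C] [Linear k C]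
    [HasZeroObject C] [HasShift C ℤ] [∀ n : ℤ, (shiftFunctor C n).Additive]
    [Pretriangulated C] [IsTriangulated C]
    [EssentiallySmall.{v} C] [IsIdempotentComplete C]
    (homFinite : ∀ A B : C, IsFiniteLength k (A ⟶ B)) :
    (HasRightSerreFunctor k E C ↔
      (∀ (c Y : C) (H : Submodule (End c)ᵐᵒᵖ (c ⟶ Y)),
        ∃ (X : C) (α : X ⟶ Y), RightDetermined α c ∧ ImHom c α = (H : Set (c ⟶ Y)))) ∧
    (HasRightSerreFunctor k E C →
      ∀ ⦃X Y : C⦄ (α : X ⟶ Y), ∃ c : C, LeftDetermined α c) := by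
  exact ⟨⟨fun h c Y H => aux_12 hE homFinite h c Y H, fun h => aux_21 hE homFinite h⟩,
    fun h X Y α => aux_13 hE h α⟩
end

section
/- Let C be a k-linear, Hom-finite, essentially small, idempotent complete triangulated category over a commutative artinian ring k, admitting a Serre functor S : C ≃ C. Let α : X → Y be a morphism in C and complete it to an exact triangle X → Y → Z → ΣX with cone Z. Then α is right determined by S⁻¹Z. -/
open CategoryTheory CategoryTheory.Limits Opposite

universe v u

/-- last part of Theorem `th:main`.  Suppose the `k`-linear Hom-finite
essentially small idempotent complete triangulated category `C` has a Serre functor `S`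
(an equivalence).  If `X ⟶ Y ⟶ Z ⟶ ΣX` is an exact triangle on `α : X ⟶ Y` with cone `Z`,
then `α` is right determined by `S⁻¹ Z`. -/
theorem stmt_17 {k : Type v} [CommRing k] [IsArtinianRing k]
    (E : Type v) [AddCommGroup E] [Module k E]
    (hE : IsInjectiveEnvelopeOfResidueField k E)
    {C : Type u} [Category.{v} C] [Preadditive C] [Linear k C]
    [HasZeroObject C] [HasShift C ℤ] [∀ n : ℤ, (shiftFunctor C n).Additive]
    [Pretriangulated C] [IsTriangulated C]
    [EssentiallySmall.{v} C] [IsIdempotentComplete C]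
    (homFinite : ∀ A B : C, IsFiniteLength k (A ⟶ B))
    (S : C ⥤ C) [S.IsEquivalence] (hS : IsRightSerreFunctor k E S)
    {X Y Z : C} (α : X ⟶ Y) (β : Y ⟶ Z) (γ : Z ⟶ X⟦(1 : ℤ)⟧)
    (hT : Pretriangulated.Triangle.mk α β γ ∈ distTriang C) :
    RightDetermined α (S.inv.obj Z) := by
  obtain ⟨_, e, he, _⟩ := hS
  have key : ∀ {A : C} (a : A ⟶ Y), FactorsThru a α ↔ a ≫ β = 0 := by
    intro A a
    constructor
    · rintro ⟨f, rfl⟩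
      have h : α ≫ β = 0 := Pretriangulated.comp_distTriang_mor_zero₁₂ _ hT
      rw [Category.assoc, h, comp_zero]
    · intro h
      obtain ⟨f, hf⟩ := Pretriangulated.Triangle.coyoneda_exact₂ _ hT a h
      exact ⟨f, hf.symm⟩
  intro X' α'
  constructor
  · rintro ⟨f, rfl⟩ φ
    exact ⟨φ ≫ f, Category.assoc _ _ _⟩
  · intro h
    rw [key]
    let i : S.obj (S.inv.obj Z) ≅ Z := S.asEquivalence.counitIso.app Z
    obtain ⟨ψ, hψ⟩ := (e (S.inv.obj Z) X').surjective ((α' ≫ β) ≫ i.inv)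
    have h0 : ψ = 0 := by
      ext φ
      have h1 := he φ ψ
      have h2 := (key _).1 (h φ)
      rw [Category.assoc] at h2
      rw [hψ, ← Category.assoc φ, h2, zero_comp, LinearEquiv.map_eq_zero_iff] at h1
      have h3 := LinearMap.congr_fun h1 (𝟙 _)
      simpa using h3
    rw [h0, map_zero] at hψ
    rw [← cancel_mono i.inv, ← hψ, zero_comp]
end
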